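/- Let r, s, t ∈ ℕ and let u_1, u_2, u_3 ∈ ℝ with |u_i| < 1/4 for each i. Let M be the 3×3 real symmetric matrix with zero diagonal and M_{12} = M_{21} = u_3, M_{13} = M_{31} = u_2, M_{23} = M_{32} = u_1, let Δ = 1 − 4u_1² − 4u_2² − 4u_3² + 16 u_1 u_2 u_3 (which is positive, so I + 2M is invertible), and set C = (I + 2M)^{−1}(I − 2M). Define H(y) = Σ_{m,n,p ≥ 0} H_{n+p+r}(y_1) H_{p+m+s}(y_2) H_{m+n+t}(y_3) u_1^m u_2^n u_3^p / (m! n! p!) (the series converges absolutely). Then for all x ∈ ℝ³: e^{−|x|²} H(√2 x) = 2^{−(r+s+t)/2} Δ^{−1/2} · [ (A_1*)^r (A_2*)^s (A_3*)^t exp(−yᵀCy) ](x), where the creation operators act in the variable y and the result is evaluated at y = x. -/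

import Mathlib

open Matrix

/-- The physicists' Hermite polynomial `H_n(x) = (-1)^n e^{x^2} (d^n/dx^n) e^{-x^2}`. -/
noncomputable def Hpoly (n : ℕ) (x : ℝ) : ℝ :=
  (-1 : ℝ) ^ n * Real.exp (x ^ 2) * iteratedDeriv n (fun y => Real.exp (-(y ^ 2))) x

/-- Partial derivative in the `j`-th coordinate of a function on `ℝ³`. -/
noncomputable def pd (j : Fin 3) (f : (Fin 3 → ℝ) → ℝ) : (Fin 3 → ℝ) → ℝ :=
  fun x => deriv (fun t => f (Function.update x j t)) (x j)

/-- The creation operator `A_j* f = -∂f/∂x_j + 2 x_j f` on functions on `ℝ³`. -/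
noncomputable def creation (j : Fin 3) (f : (Fin 3 → ℝ) → ℝ) : (Fin 3 → ℝ) → ℝ :=
  fun x => -(pd j f x) + 2 * x j * f x

/-- The triple Hermite series
`H(y) = Σ_{m,n,p} H_{n+p+r}(y₁) H_{p+m+s}(y₂) H_{m+n+t}(y₃) u₁^m u₂^n u₃^p / (m! n! p!)`. -/
noncomputable def Hser (r s t : ℕ) (u1 u2 u3 : ℝ) (y1 y2 y3 : ℝ) : ℝ :=
  ∑' q : ℕ × ℕ × ℕ,
    Hpoly (q.2.1 + q.2.2 + r) y1 * Hpoly (q.2.2 + q.1 + s) y2 * Hpoly (q.1 + q.2.1 + t) y3 *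
      u1 ^ q.1 * u2 ^ q.2.1 * u3 ^ q.2.2 /
      ((q.1.factorial : ℝ) * (q.2.1.factorial : ℝ) * (q.2.2.factorial : ℝ))

/-- The symmetric matrix `M` with zero diagonal and entries `u₃, u₂, u₁` off the diagonal. -/
noncomputable def Mmat (u1 u2 u3 : ℝ) : Matrix (Fin 3) (Fin 3) ℝ :=
  !![0, u3, u2; u3, 0, u1; u2, u1, 0]


open Real in
lemma gder (n : ℕ) (y : ℝ) : HasDerivAt (iteratedDeriv n (fun y : ℝ => Real.exp (-(y ^ 2))))
    (iteratedDeriv (n+1) (fun y : ℝ => Real.exp (-(y ^ 2))) y) y := by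
  have hc : ContDiff ℝ (⊤ : ℕ∞) (fun y : ℝ => Real.exp (-(y ^ 2))) := by fun_prop
  rw [iteratedDeriv_succ]
  apply DifferentiableAt.hasDerivAt
  exact (hc.differentiable_iteratedDeriv n (by exact_mod_cast WithTop.coe_lt_top n)).differentiableAt

lemma grec (n : ℕ) : ∀ y : ℝ, iteratedDeriv (n+1) (fun y : ℝ => Real.exp (-(y ^ 2))) y
    = -2 * y * iteratedDeriv n (fun y : ℝ => Real.exp (-(y ^ 2))) y
      - 2 * n * iteratedDeriv (n-1) (fun y : ℝ => Real.exp (-(y ^ 2))) y := by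
  induction n with
  | zero =>
    intro y
    have h : HasDerivAt (fun y : ℝ => Real.exp (-(y ^ 2))) (Real.exp (-(y^2)) * (-(2 * y))) y := by
      have := ((hasDerivAt_pow 2 y).neg).exp
      simpa using this
    have h2 := gder 0 y
    rw [iteratedDeriv_zero] at h2
    rw [h2.unique h]
    simp; ring
  | succ n ih =>
    intro y
    have e : iteratedDeriv (n+1) (fun y : ℝ => Real.exp (-(y ^ 2))) = fun y =>
       -2 * y * iteratedDeriv n (fun y : ℝ => Real.exp (-(y ^ 2))) y
      - 2 * n * iteratedDeriv (n-1) (fun y : ℝ => Real.exp (-(y ^ 2))) y := funext ih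
    have h1 := gder (n+1) y
    have h2 := (((hasDerivAt_id y).const_mul (-2)).mul (gder n y)).sub
      ((gder (n-1) y).const_mul (2 * (n:ℝ)))
    have h3 := h1.unique (h2.congr_of_eventuallyEq (Filter.Eventually.of_forall (fun z => by
      rw [e]; simp)))
    rw [h3]
    rcases n with _ | k
    · simp; ring
    · simp; ring

lemma Hrec (n : ℕ) (y : ℝ) :
    Hpoly (n+1) y = 2 * y * Hpoly n y - 2 * n * Hpoly (n-1) y := by
  unfold Hpoly
  rw [grec]
  rcases n with _ | k
  · simp; ring
  · simp [pow_succ]; ring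

lemma Hder (n : ℕ) (y : ℝ) :
    HasDerivAt (Hpoly n) (2 * y * Hpoly n y - Hpoly (n+1) y) y := by
  have h1 : HasDerivAt (fun y : ℝ => Real.exp (y ^ 2)) (Real.exp (y^2) * (2 * y)) y := by
    have := ((hasDerivAt_pow 2 y)).exp
    simpa using this
  have := (h1.const_mul ((-1:ℝ)^n)).mul (gder n y)
  refine this.congr_deriv ?_
  unfold Hpoly
  rw [pow_succ]; ring

lemma Hzero (y : ℝ) : Hpoly 0 y = 1 := by
  unfold Hpoly
  simp [← Real.exp_add]

lemma bdd_of_ev (v : ℕ → ℝ) (N : ℕ) (h : ∀ n, N ≤ n → v (n+1) ≤ v n) :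
    ∃ K, 0 < K ∧ ∀ n, v n ≤ K := by
  refine ⟨1 + ∑ i ∈ Finset.range (N+1), |v i|, by positivity, fun n => ?_⟩
  have key : ∀ i, i ≤ N → v i ≤ 1 + ∑ i ∈ Finset.range (N+1), |v i| := by
    intro i hi
    have := Finset.single_le_sum (f := fun i => |v i|) (fun j _ => abs_nonneg _)
      (Finset.mem_range.2 (Nat.lt_succ_of_le hi))
    have h2 := le_abs_self (v i)
    beta_reduce at this
    linarith
  rcases le_total n N with hn | hn
  · exact key n hn
  · induction n, hn using Nat.le_induction with
    | base => exact key N le_rfl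
    | succ n hn ih => exact (h n hn).trans ih

lemma Hbound0 (R ρ : ℝ) (hρ : 1 < ρ) : ∃ K, 0 < K ∧ ∀ n y, |y| ≤ R →
    Hpoly n y ^ 2 ≤ K * ρ ^ n * 2 ^ n * (n.factorial : ℝ) := by
  obtain ⟨σ, hσ1, hσ2⟩ := exists_between hρ
  set η := σ - 1 with hη
  have hη0 : 0 < η := by linarith
  set D := (1 + 1/η) * (4 * R^2) with hD
  have hD0 : 0 ≤ D := by positivity
  set b : ℕ → ℝ := fun n => ∏ k ∈ Finset.range n, (2 * ((k:ℝ)+2) * σ + D) with hb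
  have hb0 : ∀ n, 0 < b n := fun n => Finset.prod_pos (fun k _ => by positivity)
  have hS : ∀ n y, |y| ≤ R → Hpoly (n+1) y ^ 2 + 2 * ((n:ℝ)+1) * Hpoly n y ^ 2 ≤
      b n * (4 * R^2 + 2) := by
    intro n y hy
    have hy2 : y ^ 2 ≤ R ^ 2 := sq_le_sq' (by linarith [neg_abs_le y]) (by linarith [le_abs_self y])
    induction n with
    | zero =>
      have := Hrec 0 y
      simp [Hzero] at this
      simp [hb, Hzero, this]
      nlinarith
    | succ n ih =>
      have e := Hrec (n+1) y
      simp only [Nat.add_sub_cancel] at e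
      have eb : b (n+1) = b n * (2 * ((n:ℝ)+2) * σ + D) := by
        simp [hb, Finset.prod_range_succ]
      rw [e, eb]
      push_cast
      set p := Hpoly (n+1) y
      set q := Hpoly n y
      have hn : (0:ℝ) ≤ n := Nat.cast_nonneg n
      have young : (2 * y * p - 2 * ((n:ℝ)+1) * q)^2 ≤
          (1+1/η) * (4 * y^2) * p^2 + σ * (4 * ((n:ℝ)+1)^2) * q^2 := by
        have : (1+1/η) * (4 * y^2) * p^2 + σ * (4 * ((n:ℝ)+1)^2) * q^2
          - (2 * y * p - 2 * ((n:ℝ)+1) * q)^2 = (2 * y * p + η * (2 * ((n:ℝ)+1) * q))^2 / η := by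
          have : σ = η + 1 := by rw [hη]; ring
          rw [this]
          field_simp
          ring
        have h2 : 0 ≤ (2 * y * p + η * (2 * ((n:ℝ)+1) * q))^2 / η := by positivity
        linarith
      have hDy : (1+1/η) * (4 * y^2) * p^2 ≤ D * p^2 := by
        rw [hD]; gcongr
      calc _ ≤ D * p^2 + σ * (4 * ((n:ℝ)+1)^2) * q^2 + 2 * ((n:ℝ)+1+1) * p^2 := by linarith
        _ ≤ (p^2 + 2 * ((n:ℝ)+1) * q^2) * (2 * ((n:ℝ)+2) * σ + D) := by
          have h1 : 0 ≤ p^2 * ((n+2) * η) := by positivity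
          have h2 : 0 ≤ q^2 * (((n:ℝ)+1) * σ) := by positivity
          have h3 : 0 ≤ q^2 * (((n:ℝ)+1) * D) := by positivity
          have : η = σ - 1 := hη
          rw [this] at h1
          nlinarith
        _ ≤ (b n * (4 * R^2 + 2)) * (2 * ((n:ℝ)+2) * σ + D) := by gcongr
        _ = _ := by ring
  obtain ⟨N, hN⟩ := exists_nat_ge (D / (2 * (ρ - σ)))
  obtain ⟨K, hK0, hK⟩ := bdd_of_ev (fun n => b n / (ρ ^ n * 2 ^ n * ((n+1).factorial : ℝ))) N (by
    intro n hn
    have eb : b (n+1) = b n * (2 * ((n:ℝ)+2) * σ + D) := by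
        simp [hb, Finset.prod_range_succ]
    have hle : 2 * ((n:ℝ)+2) * σ + D ≤ 2 * ((n:ℝ)+2) * ρ := by
      rw [div_le_iff₀ (by linarith)] at hN
      have : (N:ℝ) ≤ n := by exact_mod_cast hn
      nlinarith
    have hρ0 : 0 < ρ := by linarith
    beta_reduce
    rw [div_le_div_iff₀ (by positivity) (by positivity), eb, Nat.factorial_succ (n+1)]
    push_cast
    have := hb0 n
    calc _ = (b n * ρ^n * 2^n * ((n+1).factorial:ℝ)) * (2 * ((n:ℝ)+2) * σ + D) := by ring
      _ ≤ (b n * ρ^n * 2^n * ((n+1).factorial:ℝ)) * (2 * ((n:ℝ)+2) * ρ) := by gcongr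
      _ = _ := by ring)
  have hρ0 : 0 < ρ := by linarith
  refine ⟨K * (4 * R^2+2), by positivity, fun n y hy => ?_⟩
  have h1 := hS n y hy
  have h2 := hK n
  beta_reduce at h2
  rw [div_le_iff₀ (by positivity), Nat.factorial_succ] at h2
  push_cast at h2
  have h3 : 2 * ((n:ℝ)+1) * Hpoly n y ^ 2 ≤ b n * (4 * R^2 + 2) := by nlinarith [sq_nonneg (Hpoly (n+1) y)]
  have h4 : b n * (4 * R^2 + 2) ≤ (K * (ρ ^ n * 2 ^ n * (((n:ℝ) + 1) * (n.factorial : ℝ)))) * (4 * R^2+2) := by gcongr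
  have hn : (0:ℝ) < (n:ℝ)+1 := by positivity
  have h5 : ((n:ℝ)+1) * Hpoly n y ^ 2 ≤ ((n:ℝ)+1) * (K * (4 * R^2+2) * ρ ^ n * 2 ^ n * (n.factorial : ℝ)) := by
    nlinarith [mul_nonneg hn.le (sq_nonneg (Hpoly n y))]
  exact le_of_mul_le_mul_left h5 hn

lemma nat_le_pow (σ : ℝ) (hσ : 1 < σ) (n : ℕ) : (n:ℝ) ≤ σ^n / (σ - 1) := by
  rw [le_div_iff₀ (by linarith)]
  have := one_add_mul_le_pow (a := σ - 1) (by linarith) n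
  simp at this
  linarith

lemma Hbound1 (r : ℕ) : ∀ R ρ : ℝ, 1 < ρ → ∃ K, 0 < K ∧ ∀ n y, |y| ≤ R →
    Hpoly (n+r) y ^ 2 ≤ K * ρ ^ n * 2 ^ n * (n.factorial : ℝ) := by
  induction r with
  | zero => exact fun R ρ h => Hbound0 R ρ h
  | succ r ih =>
    intro R ρ hρ
    obtain ⟨σ, hσ1, hσ2⟩ := exists_between (Real.lt_sqrt_of_sq_lt (by simpa using hρ : (1:ℝ)^2 < ρ))
    have hσρ : σ * σ ≤ ρ := by
      have := Real.sq_sqrt (by linarith : 0 ≤ ρ)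
      nlinarith
    obtain ⟨K, hK0, hK⟩ := ih R σ hσ1
    refine ⟨K * σ * 2 * (σ / (σ-1)), by have : 0 < σ - 1 := by linarith
                                        positivity, fun n y hy => ?_⟩
    have h1 := hK (n+1) y hy
    have h2 := nat_le_pow σ hσ1 (n+1)
    rw [show n + 1 + r = n + (r+1) by ring, Nat.factorial_succ] at h1
    refine h1.trans ?_
    have h3 : 0 < σ - 1 := by linarith
    have hσ0 : 0 < σ := by linarith
    push_cast at h2 ⊢
    calc _ = K * σ^(n+1) * 2^(n+1) * n.factorial * ((n:ℝ)+1) := by ring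
      _ ≤ K * σ^(n+1) * 2^(n+1) * n.factorial * (σ^(n+1) / (σ-1)) := by gcongr
      _ = K * σ * 2 * (σ / (σ-1)) * (σ*σ)^n * 2^n * n.factorial := by rw [mul_pow]; ring
      _ ≤ _ := by gcongr

lemma Hbound2 (r : ℕ) (R ρ : ℝ) (hρ : 1 < ρ) : ∃ K, 0 < K ∧ ∀ n p y, |y| ≤ R →
    |Hpoly (n+p+r) y| ≤ K * (2 * ρ) ^ (n+p) * (√(n.factorial : ℝ) * √(p.factorial : ℝ)) := by
  obtain ⟨K, hK0, hK⟩ := Hbound1 r R ρ hρ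
  have hρ0 : 0 < ρ := by linarith
  refine ⟨√K, by positivity, fun n p y hy => ?_⟩
  apply abs_le_of_sq_le_sq _ (by positivity)
  refine (hK (n+p) y hy).trans ?_
  have h1 : ((n+p).factorial : ℝ) ≤ 2^(n+p) * (n.factorial * p.factorial) := by
    have h2 := Nat.add_choose_mul_factorial_mul_factorial n p
    have h3 : (n+p).choose p ≤ 2^(n+p) := Nat.choose_le_two_pow _ _
    rw [← h2]
    push_cast
    have : (((n+p).choose p : ℕ) : ℝ) ≤ 2^(n+p) := by exact_mod_cast h3
    rw [mul_assoc]
    gcongr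
  have h4 : ρ ^ (n+p) ≤ ρ^(n+p) * ρ^(n+p) := by
    have : 1 ≤ ρ^(n+p) := one_le_pow₀ hρ.le
    nlinarith
  simp only [mul_pow, Real.sq_sqrt hK0.le, Real.sq_sqrt (Nat.cast_nonneg (α := ℝ) _)]
  calc _ ≤ K * (ρ^(n+p) * ρ^(n+p)) * 2^(n+p) * (2^(n+p) * (n.factorial * p.factorial)) := by gcongr
    _ = _ := by ring

/-- term of the series -/
noncomputable def TT (r s t : ℕ) (u1 u2 u3 y1 y2 y3 : ℝ) (q : ℕ × ℕ × ℕ) : ℝ :=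
    Hpoly (q.2.1 + q.2.2 + r) y1 * Hpoly (q.2.2 + q.1 + s) y2 * Hpoly (q.1 + q.2.1 + t) y3 *
      u1 ^ q.1 * u2 ^ q.2.1 * u3 ^ q.2.2 /
      ((q.1.factorial : ℝ) * (q.2.1.factorial : ℝ) * (q.2.2.factorial : ℝ))

lemma Hser_eq (r s t : ℕ) (u1 u2 u3 y1 y2 y3 : ℝ) :
    Hser r s t u1 u2 u3 y1 y2 y3 = ∑' q, TT r s t u1 u2 u3 y1 y2 y3 q := rfl

lemma geo3 (θ : ℝ) (h0 : 0 ≤ θ) (h1 : θ < 1) :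
    Summable (fun q : ℕ × ℕ × ℕ => θ ^ (q.1 + q.2.1 + q.2.2)) := by
  have g := summable_geometric_of_lt_one h0 h1
  have hn : (0 : ℕ → ℝ) ≤ fun n => θ ^ n := fun n => pow_nonneg h0 n
  have g2 := g.mul_of_nonneg g hn hn
  have g3 := g.mul_of_nonneg g2 hn (fun q => mul_nonneg (hn _) (hn _))
  refine g3.congr (fun q => ?_)
  rw [pow_add, pow_add]; ring

lemma geo3N (θ : ℝ) (h0 : 0 ≤ θ) (h1 : θ < 1) :
    Summable (fun q : ℕ × ℕ × ℕ => ((q.1 + q.2.1 + q.2.2 : ℕ) : ℝ) * θ ^ (q.1 + q.2.1 + q.2.2)) := by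
  obtain ⟨φ, hφ1, hφ2⟩ := exists_between h1
  have hφ0 : 0 < φ := by linarith
  obtain ⟨σ, hσ0, hσ1⟩ := exists_between ((one_lt_inv₀ hφ0).2 hφ2)
  have hσφ : σ * φ < 1 := by
    have := mul_lt_mul_of_pos_right hσ1 hφ0
    rwa [inv_mul_cancel₀ hφ0.ne'] at this
  have g := (geo3 (σ * φ) (by positivity) hσφ).mul_left (1 / (σ - 1))
  refine Summable.of_nonneg_of_le (fun q => by positivity) (fun q => ?_) g
  have h := nat_le_pow σ hσ0 (q.1 + q.2.1 + q.2.2)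
  have h3 : 0 < σ - 1 := by linarith
  calc _ ≤ (σ ^ (q.1 + q.2.1 + q.2.2) / (σ-1)) * φ ^ (q.1 + q.2.1 + q.2.2) := by gcongr
    _ = _ := by rw [mul_pow]; ring

lemma TTbound (r s t : ℕ) (R w : ℝ) (hw0 : 0 ≤ w) (hw : w < 1/4) :
    ∃ K θ, 0 < K ∧ 0 ≤ θ ∧ θ < 1 ∧ ∀ u1 u2 u3 y1 y2 y3 q, |u1| ≤ w → |u2| ≤ w → |u3| ≤ w →
      |y1| ≤ R → |y2| ≤ R → |y3| ≤ R →
      |TT r s t u1 u2 u3 y1 y2 y3 q| ≤ K * θ ^ (q.1 + q.2.1 + q.2.2) := by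
  have : ∃ ρ : ℝ, 1 < ρ ∧ 4 * ρ^2 * w < 1 := by
    rcases hw0.eq_or_lt with h | h
    · exact ⟨2, by norm_num, by rw [← h]; norm_num⟩
    · have h2 : 1 < 1 / (4 * w) := by rw [lt_div_iff₀ (by linarith)]; linarith
      obtain ⟨ρ, h3, h4⟩ := exists_between (Real.lt_sqrt_of_sq_lt (by simpa using h2 : (1:ℝ)^2 < 1 / (4*w)))
      refine ⟨ρ, h3, ?_⟩
      have h5 := (Real.lt_sqrt (by linarith)).1 h4
      rw [lt_div_iff₀ (by linarith)] at h5
      linarith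
  obtain ⟨ρ, hρ, hθ⟩ := this
  obtain ⟨K1, hK1, H1⟩ := Hbound2 r R ρ hρ
  obtain ⟨K2, hK2, H2⟩ := Hbound2 s R ρ hρ
  obtain ⟨K3, hK3, H3⟩ := Hbound2 t R ρ hρ
  have hρ0 : 0 < ρ := by linarith
  refine ⟨K1 * K2 * K3, 4 * ρ^2 * w, by positivity, by positivity, hθ, ?_⟩
  rintro u1 u2 u3 y1 y2 y3 ⟨m, n, p⟩ hu1 hu2 hu3 hy1 hy2 hy3
  simp only [TT]
  rw [abs_div, abs_mul, abs_mul, abs_mul, abs_mul, abs_mul, abs_pow, abs_pow, abs_pow]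
  rw [abs_of_pos (by positivity : (0:ℝ) < m.factorial * n.factorial * p.factorial),
    div_le_iff₀ (by positivity)]
  have e1 := H1 n p y1 hy1
  have e2 := H2 p m y2 hy2
  have e3 := H3 m n y3 hy3
  have sm := Real.mul_self_sqrt (Nat.cast_nonneg (α := ℝ) m.factorial)
  have sn := Real.mul_self_sqrt (Nat.cast_nonneg (α := ℝ) n.factorial)
  have sp := Real.mul_self_sqrt (Nat.cast_nonneg (α := ℝ) p.factorial)
  calc _ ≤ (K1 * (2 * ρ) ^ (n+p) * (√(n.factorial : ℝ) * √(p.factorial : ℝ))) *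
        (K2 * (2 * ρ) ^ (p+m) * (√(p.factorial : ℝ) * √(m.factorial : ℝ))) *
        (K3 * (2 * ρ) ^ (m+n) * (√(m.factorial : ℝ) * √(n.factorial : ℝ))) *
        w^m * w^n * w^p := by gcongr
    _ = K1 * K2 * K3 * (4 * ρ ^ 2 * w) ^ (m+n+p) * ((√(m.factorial : ℝ) * √(m.factorial : ℝ)) * (√(n.factorial : ℝ) * √(n.factorial : ℝ)) * (√(p.factorial : ℝ) * √(p.factorial : ℝ))) := by
      rw [show 4 * ρ^2 * w = (2*ρ)*(2*ρ)*w by ring]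
      generalize 2 * ρ = z
      rw [mul_pow, mul_pow]
      ring
    _ = _ := by rw [sm, sn, sp]

lemma exists_w (u1 u2 u3 : ℝ) (h1 : |u1| < 1/4) (h2 : |u2| < 1/4) (h3 : |u3| < 1/4) :
    ∃ w, 0 ≤ w ∧ w < 1/4 ∧ |u1| ≤ w ∧ |u2| ≤ w ∧ |u3| ≤ w :=
  ⟨max |u1| (max |u2| |u3|), by positivity, by simp; norm_num at *; tauto, by simp, by simp, by simp⟩

lemma TTabs (r s t : ℕ) (u1 u2 u3 y1 y2 y3 : ℝ) (h1 : |u1| < 1/4) (h2 : |u2| < 1/4)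
    (h3 : |u3| < 1/4) : Summable (fun q => |TT r s t u1 u2 u3 y1 y2 y3 q|) := by
  obtain ⟨w, hw0, hw, a1, a2, a3⟩ := exists_w u1 u2 u3 h1 h2 h3
  obtain ⟨K, θ, hK, hθ0, hθ1, H⟩ := TTbound r s t (max |y1| (max |y2| |y3|)) w hw0 hw
  exact Summable.of_nonneg_of_le (fun q => abs_nonneg _)
    (fun q => H u1 u2 u3 y1 y2 y3 q a1 a2 a3 (by simp) (by simp) (by simp))
    ((geo3 θ hθ0 hθ1).mul_left K)

lemma TTsum (r s t : ℕ) (u1 u2 u3 y1 y2 y3 : ℝ) (h1 : |u1| < 1/4) (h2 : |u2| < 1/4)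
    (h3 : |u3| < 1/4) : HasSum (TT r s t u1 u2 u3 y1 y2 y3) (Hser r s t u1 u2 u3 y1 y2 y3) :=
  (TTabs r s t u1 u2 u3 y1 y2 y3 h1 h2 h3).of_abs.hasSum

lemma Hcyc (r s t : ℕ) (u1 u2 u3 y1 y2 y3 : ℝ) :
    Hser r s t u1 u2 u3 y1 y2 y3 = Hser s t r u2 u3 u1 y2 y3 y1 := by
  let e : ℕ × ℕ × ℕ ≃ ℕ × ℕ × ℕ :=
    ⟨fun q => (q.2.1, q.2.2, q.1), fun q => (q.2.2, q.1, q.2.1), fun q => rfl, fun q => rfl⟩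
  rw [Hser_eq, Hser_eq, ← e.tsum_eq (TT s t r u2 u3 u1 y2 y3 y1)]
  refine tsum_congr (fun q => ?_)
  simp only [TT, e, Equiv.coe_fn_mk]
  ring

lemma Hser_deriv1 (r s t : ℕ) (u1 u2 u3 y1 y2 y3 : ℝ) (h1 : |u1| < 1/4) (h2 : |u2| < 1/4)
    (h3 : |u3| < 1/4) : HasDerivAt (fun y => Hser r s t u1 u2 u3 y y2 y3)
      (2 * y1 * Hser r s t u1 u2 u3 y1 y2 y3 - Hser (r+1) s t u1 u2 u3 y1 y2 y3) y1 := by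
  obtain ⟨w, hw0, hw, a1, a2, a3⟩ := exists_w u1 u2 u3 h1 h2 h3
  set R := 1 + max |y1| (max |y2| |y3|) with hR
  have hy1 : |y1| < R := by
    have : |y1| ≤ max |y1| (max |y2| |y3|) := by simp
    linarith
  have hy2 : |y2| ≤ R := by
    have : |y2| ≤ max |y1| (max |y2| |y3|) := by simp
    linarith
  have hy3 : |y3| ≤ R := by
    have : |y3| ≤ max |y1| (max |y2| |y3|) := by simp
    linarith
  have hR0 : 0 ≤ R := (abs_nonneg _).trans hy2
  obtain ⟨K, θ, hK, hθ0, hθ1, H⟩ := TTbound r s t R w hw0 hw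
  obtain ⟨K', θ', hK', hθ0', hθ1', H'⟩ := TTbound (r+1) s t R w hw0 hw
  have hs := TTsum r s t u1 u2 u3 y1 y2 y3 h1 h2 h3
  have hs' := TTsum (r+1) s t u1 u2 u3 y1 y2 y3 h1 h2 h3
  have hmem : y1 ∈ Metric.ball (0:ℝ) R := by simpa using hy1
  have key := hasDerivAt_tsum_of_isPreconnected
    (g := fun q y => TT r s t u1 u2 u3 y y2 y3 q)
    (g' := fun q y => 2 * y * TT r s t u1 u2 u3 y y2 y3 q - TT (r+1) s t u1 u2 u3 y y2 y3 q)
    (t := Metric.ball (0:ℝ) R) (y₀ := y1) (y := y1)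
    (u := fun q => 2 * R * (K * θ ^ (q.1 + q.2.1 + q.2.2)) + K' * θ' ^ (q.1 + q.2.1 + q.2.2))
    ((((geo3 θ hθ0 hθ1).mul_left K).mul_left (2 * R)).add ((geo3 θ' hθ0' hθ1').mul_left K'))
    Metric.isOpen_ball (convex_ball 0 R).isPreconnected ?_ ?_ hmem hs.summable hmem
  · refine key.congr_deriv ?_
    exact ((hs.mul_left (2 * y1)).sub hs').tsum_eq
  · intro q y _
    have := (Hder (q.2.1 + q.2.2 + r) y).mul_const (Hpoly (q.2.2 + q.1 + s) y2 * Hpoly (q.1 + q.2.1 + t) y3 *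
      u1 ^ q.1 * u2 ^ q.2.1 * u3 ^ q.2.2 /
      ((q.1.factorial : ℝ) * (q.2.1.factorial : ℝ) * (q.2.2.factorial : ℝ)))
    convert! this using 1
    · funext y
      simp only [TT]; ring
    · simp only [TT, add_assoc]; ring
  · intro q y hy
    have hy' : |y| ≤ R := by simpa using (le_of_lt (by simpa using hy) : |y| ≤ R)
    have b1 := H u1 u2 u3 y y2 y3 q a1 a2 a3 hy' hy2 hy3
    have b2 := H' u1 u2 u3 y y2 y3 q a1 a2 a3 hy' hy2 hy3
    rw [Real.norm_eq_abs]
    refine (abs_sub _ _).trans ?_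
    rw [abs_mul, abs_mul, abs_two]
    gcongr

/-- Row 1 of the linear recursion. -/
lemma shiftm (f : ℕ × ℕ × ℕ → ℝ) (a : ℝ) (h0 : ∀ n p, f (0, n, p) = 0)
    (h : HasSum (fun q : ℕ × ℕ × ℕ => f (q.1 + 1, q.2.1, q.2.2)) a) : HasSum f a := by
  have hi : Function.Injective (fun q : ℕ × ℕ × ℕ => (q.1 + 1, q.2.1, q.2.2)) := by
    rintro ⟨a, b, c⟩ ⟨a', b', c'⟩ h
    simp at h ⊢; exact h
  refine (hi.hasSum_iff ?_).1 h
  rintro ⟨m, n, p⟩ hx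
  rcases m with _ | m
  · exact h0 n p
  · exact absurd ⟨(m, n, p), rfl⟩ hx

lemma shiftn (f : ℕ × ℕ × ℕ → ℝ) (a : ℝ) (h0 : ∀ n p, f (n, 0, p) = 0)
    (h : HasSum (fun q : ℕ × ℕ × ℕ => f (q.1, q.2.1 + 1, q.2.2)) a) : HasSum f a := by
  have hi : Function.Injective (fun q : ℕ × ℕ × ℕ => (q.1, q.2.1 + 1, q.2.2)) := by
    rintro ⟨a, b, c⟩ ⟨a', b', c'⟩ h
    simp at h ⊢; exact h
  refine (hi.hasSum_iff ?_).1 h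
  rintro ⟨m, n, p⟩ hx
  rcases n with _ | n
  · exact h0 m p
  · exact absurd ⟨(m, n, p), rfl⟩ hx

lemma shiftp (f : ℕ × ℕ × ℕ → ℝ) (a : ℝ) (h0 : ∀ n p, f (n, p, 0) = 0)
    (h : HasSum (fun q : ℕ × ℕ × ℕ => f (q.1, q.2.1, q.2.2 + 1)) a) : HasSum f a := by
  have hi : Function.Injective (fun q : ℕ × ℕ × ℕ => (q.1, q.2.1, q.2.2 + 1)) := by
    rintro ⟨a, b, c⟩ ⟨a', b', c'⟩ h
    simp at h ⊢; exact h
  refine (hi.hasSum_iff ?_).1 h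
  rintro ⟨m, n, p⟩ hx
  rcases p with _ | p
  · exact h0 m n
  · exact absurd ⟨(m, n, p), rfl⟩ hx

lemma row1 (r s t : ℕ) (u1 u2 u3 y1 y2 y3 : ℝ) (h1 : |u1| < 1/4) (h2 : |u2| < 1/4)
    (h3 : |u3| < 1/4) :
    Hser (r+1) s t u1 u2 u3 y1 y2 y3 + 2 * u3 * Hser r (s+1) t u1 u2 u3 y1 y2 y3
      + 2 * u2 * Hser r s (t+1) u1 u2 u3 y1 y2 y3
    = 2 * y1 * Hser r s t u1 u2 u3 y1 y2 y3 - 2 * r * Hser (r-1) s t u1 u2 u3 y1 y2 y3 := by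
  set c : ℕ × ℕ × ℕ → ℝ := fun q =>
    Hpoly (q.2.1 + q.2.2 + r - 1) y1 * Hpoly (q.2.2 + q.1 + s) y2 * Hpoly (q.1 + q.2.1 + t) y3 *
      u1 ^ q.1 * u2 ^ q.2.1 * u3 ^ q.2.2 /
      ((q.1.factorial : ℝ) * (q.2.1.factorial : ℝ) * (q.2.2.factorial : ℝ)) with hc
  have A := TTsum (r+1) s t u1 u2 u3 y1 y2 y3 h1 h2 h3
  have B := TTsum r s t u1 u2 u3 y1 y2 y3 h1 h2 h3
  have N : HasSum (fun q => (q.2.1 : ℝ) * c q) (u2 * Hser r s (t+1) u1 u2 u3 y1 y2 y3) := by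
    refine shiftn _ _ (fun n p => by simp) ?_
    convert! (TTsum r s (t+1) u1 u2 u3 y1 y2 y3 h1 h2 h3).mul_left u2 using 1
    funext q
    simp only [hc, TT]
    rw [show q.2.1 + 1 + q.2.2 + r - 1 = q.2.1 + q.2.2 + r by omega,
      show q.1 + (q.2.1 + 1) + t = q.1 + q.2.1 + (t+1) by omega, Nat.factorial_succ]
    have : ((q.2.1 : ℝ) + 1) ≠ 0 := by positivity
    push_cast
    field_simp
    try ring
  have P : HasSum (fun q => (q.2.2 : ℝ) * c q) (u3 * Hser r (s+1) t u1 u2 u3 y1 y2 y3) := by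
    refine shiftp _ _ (fun n p => by simp) ?_
    convert! (TTsum r (s+1) t u1 u2 u3 y1 y2 y3 h1 h2 h3).mul_left u3 using 1
    funext q
    simp only [hc, TT]
    rw [show q.2.1 + (q.2.2 + 1) + r - 1 = q.2.1 + q.2.2 + r by omega,
      show q.2.2 + 1 + q.1 + s = q.2.2 + q.1 + (s+1) by omega, Nat.factorial_succ]
    have : ((q.2.2 : ℝ) + 1) ≠ 0 := by positivity
    push_cast
    field_simp
    try ring
  have Rr : HasSum (fun q => (r : ℝ) * c q) (r * Hser (r-1) s t u1 u2 u3 y1 y2 y3) := by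
    convert! (TTsum (r-1) s t u1 u2 u3 y1 y2 y3 h1 h2 h3).mul_left (r:ℝ) using 1
    funext q
    rcases r with _ | r
    · simp
    · simp only [hc, TT]
      rw [show q.2.1 + q.2.2 + (r+1) - 1 = q.2.1 + q.2.2 + (r + 1 - 1) by omega]
  have tot := ((B.mul_left (2 * y1)).sub (((N.add P).add Rr).mul_left 2))
  have := A.unique (tot.congr_fun ?_)
  · linear_combination this
  · intro q
    have e := Hrec (q.2.1 + q.2.2 + r) y1
    simp only [hc, TT]
    rw [← add_assoc (q.2.1 + q.2.2) r 1, e]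
    push_cast
    ring

lemma row2 (r s t : ℕ) (u1 u2 u3 y1 y2 y3 : ℝ) (h1 : |u1| < 1/4) (h2 : |u2| < 1/4)
    (h3 : |u3| < 1/4) :
    Hser r (s+1) t u1 u2 u3 y1 y2 y3 + 2 * u1 * Hser r s (t+1) u1 u2 u3 y1 y2 y3
      + 2 * u3 * Hser (r+1) s t u1 u2 u3 y1 y2 y3
    = 2 * y2 * Hser r s t u1 u2 u3 y1 y2 y3 - 2 * s * Hser r (s-1) t u1 u2 u3 y1 y2 y3 := by
  have := row1 s t r u2 u3 u1 y2 y3 y1 h2 h3 h1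
  simpa only [← Hcyc] using this

lemma row3 (r s t : ℕ) (u1 u2 u3 y1 y2 y3 : ℝ) (h1 : |u1| < 1/4) (h2 : |u2| < 1/4)
    (h3 : |u3| < 1/4) :
    Hser r s (t+1) u1 u2 u3 y1 y2 y3 + 2 * u2 * Hser (r+1) s t u1 u2 u3 y1 y2 y3
      + 2 * u1 * Hser r (s+1) t u1 u2 u3 y1 y2 y3
    = 2 * y3 * Hser r s t u1 u2 u3 y1 y2 y3 - 2 * t * Hser r s (t-1) u1 u2 u3 y1 y2 y3 := by
  have := row1 t r s u3 u1 u2 y3 y1 y2 h3 h1 h2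
  simpa only [Hcyc t, Hcyc (t+1), Hcyc (t-1)] using this

lemma Hser_deriv2 (r s t : ℕ) (u1 u2 u3 y1 y2 y3 : ℝ) (h1 : |u1| < 1/4) (h2 : |u2| < 1/4)
    (h3 : |u3| < 1/4) : HasDerivAt (fun y => Hser r s t u1 u2 u3 y1 y y3)
      (2 * y2 * Hser r s t u1 u2 u3 y1 y2 y3 - Hser r (s+1) t u1 u2 u3 y1 y2 y3) y2 := by
  have := Hser_deriv1 s t r u2 u3 u1 y2 y3 y1 h2 h3 h1
  simpa only [← Hcyc] using this

lemma Hser_deriv3 (r s t : ℕ) (u1 u2 u3 y1 y2 y3 : ℝ) (h1 : |u1| < 1/4) (h2 : |u2| < 1/4)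
    (h3 : |u3| < 1/4) : HasDerivAt (fun y => Hser r s t u1 u2 u3 y1 y2 y)
      (2 * y3 * Hser r s t u1 u2 u3 y1 y2 y3 - Hser r s (t+1) u1 u2 u3 y1 y2 y3) y3 := by
  have := Hser_deriv1 t r s u3 u1 u2 y3 y1 y2 h3 h1 h2
  simpa only [Hcyc t, Hcyc (t+1)] using this

lemma detpos (a b c : ℝ) (h1 : |a| < 1/4) (h2 : |b| < 1/4) (h3 : |c| < 1/4) :
    0 < 1 - 4*a^2 - 4*b^2 - 4*c^2 + 16*a*b*c := by
  have ha : a^2 < 1/16 := by rw [← sq_abs]; nlinarith [abs_nonneg a]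
  have hb : b^2 < 1/16 := by rw [← sq_abs]; nlinarith [abs_nonneg b]
  have h4 : |2 * c - 4 * (a * b)| < 3/4 := by
    have h5 : |a * b| ≤ 1/16 := by
      rw [abs_mul]; nlinarith [abs_nonneg a, abs_nonneg b]
    rw [abs_le] at h5
    rw [abs_lt] at h3 ⊢
    constructor <;> linarith [h3.1, h3.2, h5.1, h5.2]
  have h6 : (2 * c - 4 * (a * b))^2 < 9/16 := by
    rw [← sq_abs]; nlinarith [abs_nonneg (2 * c - 4 * (a * b))]
  have h7 : 9/16 ≤ (1 - 4*a^2) * (1 - 4 * b^2) := by nlinarith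
  nlinarith

lemma Hser_zero (y1 y2 y3 : ℝ) : Hser 0 0 0 0 0 0 y1 y2 y3 = 1 := by
  rw [Hser_eq, tsum_eq_single (0, 0, 0)]
  · simp [TT, Hzero]
  · rintro ⟨m, n, p⟩ h
    simp only [TT]
    rcases m with _ | m
    · rcases n with _ | n
      · rcases p with _ | p
        · exact absurd rfl h
        · simp
      · simp
    · simp

lemma TT_scale (τ : ℝ) (r s t : ℕ) (u1 u2 u3 y1 y2 y3 : ℝ) (q : ℕ × ℕ × ℕ) :
    TT r s t (τ * u1) (τ * u2) (τ * u3) y1 y2 y3 q =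
      τ ^ (q.1 + q.2.1 + q.2.2) * TT r s t u1 u2 u3 y1 y2 y3 q := by
  simp only [TT, mul_pow, pow_add]; ring

lemma sc_lt (τ u : ℝ) (h0 : 0 ≤ τ) (h1 : τ ≤ 1) (h : |u| < 1/4) : |τ * u| < 1/4 := by
  rw [abs_mul, abs_of_nonneg h0]
  nlinarith [abs_nonneg u]

set_option maxHeartbeats 2000000 in
lemma Hser_tau (r s t : ℕ) (u1 u2 u3 y1 y2 y3 : ℝ) (h1 : |u1| < 1/4) (h2 : |u2| < 1/4)
    (h3 : |u3| < 1/4) (τ : ℝ) (hτ0 : 0 ≤ τ) (hτ1 : τ ≤ 1) :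
    HasDerivAt (fun τ => Hser r s t (τ * u1) (τ * u2) (τ * u3) y1 y2 y3)
      (u1 * Hser r (s+1) (t+1) (τ * u1) (τ * u2) (τ * u3) y1 y2 y3
      + u2 * Hser (r+1) s (t+1) (τ * u1) (τ * u2) (τ * u3) y1 y2 y3
      + u3 * Hser (r+1) (s+1) t (τ * u1) (τ * u2) (τ * u3) y1 y2 y3) τ := by
  obtain ⟨w, hw0, hw, a1, a2, a3⟩ := exists_w u1 u2 u3 h1 h2 h3
  obtain ⟨w', hw1, hw2⟩ := exists_between hw
  have hw'0 : 0 < w' := by linarith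
  obtain ⟨c, hc1, hcw⟩ : ∃ c : ℝ, 1 < c ∧ c * w ≤ w' := by
    rcases hw0.eq_or_lt with h | h
    · exact ⟨2, by norm_num, by rw [← h]; linarith⟩
    · exact ⟨w' / w, by rwa [one_lt_div h], by rw [div_mul_cancel₀ _ h.ne']⟩
  have hc0 : 0 < c := by linarith
  obtain ⟨K, θ, hK, hθ0, hθ1, H⟩ := TTbound r s t (max |y1| (max |y2| |y3|)) w' hw'0.le hw2
  have hcu : ∀ u, |u| ≤ w → |c * u| ≤ w' := fun u hu => by
    rw [abs_mul, abs_of_pos hc0]; nlinarith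
  have k1 := sc_lt τ u1 hτ0 hτ1 h1
  have k2 := sc_lt τ u2 hτ0 hτ1 h2
  have k3 := sc_lt τ u3 hτ0 hτ1 h3
  have hmem : τ ∈ Metric.ball (0:ℝ) c := by simp [abs_of_nonneg hτ0]; linarith
  have key := hasDerivAt_tsum_of_isPreconnected
    (g := fun q τ => τ ^ (q.1 + q.2.1 + q.2.2) * TT r s t u1 u2 u3 y1 y2 y3 q)
    (g' := fun q τ => (((q.1 + q.2.1 + q.2.2 : ℕ) : ℝ) * τ ^ (q.1 + q.2.1 + q.2.2 - 1)) * TT r s t u1 u2 u3 y1 y2 y3 q)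
    (t := Metric.ball (0:ℝ) c) (y₀ := τ) (y := τ)
    (u := fun q => K * (((q.1 + q.2.1 + q.2.2 : ℕ) : ℝ) * θ ^ (q.1 + q.2.1 + q.2.2)))
    ((geo3N θ hθ0 hθ1).mul_left K)
    Metric.isOpen_ball (convex_ball 0 c).isPreconnected ?_ ?_ hmem ?_ hmem
  · simp only [← TT_scale] at key
    refine key.congr_deriv ?_
    have M : HasSum (fun q : ℕ × ℕ × ℕ => ((q.1 : ℝ) * τ ^ (q.1 + q.2.1 + q.2.2 - 1)) * TT r s t u1 u2 u3 y1 y2 y3 q)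
        (u1 * Hser r (s+1) (t+1) (τ * u1) (τ * u2) (τ * u3) y1 y2 y3) := by
      refine shiftm _ _ (fun n p => by simp) ?_
      convert! (TTsum r (s+1) (t+1) _ _ _ y1 y2 y3 k1 k2 k3).mul_left u1 using 1
      funext q
      rw [TT_scale]
      simp only [TT]
      rw [show q.1 + 1 + q.2.1 + q.2.2 - 1 = q.1 + q.2.1 + q.2.2 by omega,
        show q.1 + 1 + q.2.1 + t = q.1 + q.2.1 + (t+1) by omega,
        show q.2.2 + (q.1 + 1) + s = q.2.2 + q.1 + (s+1) by omega, Nat.factorial_succ]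
      have : ((q.1 : ℝ) + 1) ≠ 0 := by positivity
      push_cast
      field_simp
      try ring
    have N : HasSum (fun q : ℕ × ℕ × ℕ => ((q.2.1 : ℝ) * τ ^ (q.1 + q.2.1 + q.2.2 - 1)) * TT r s t u1 u2 u3 y1 y2 y3 q)
        (u2 * Hser (r+1) s (t+1) (τ * u1) (τ * u2) (τ * u3) y1 y2 y3) := by
      refine shiftn _ _ (fun n p => by simp) ?_
      convert! (TTsum (r+1) s (t+1) _ _ _ y1 y2 y3 k1 k2 k3).mul_left u2 using 1
      funext q
      rw [TT_scale]
      simp only [TT]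
      rw [show q.1 + (q.2.1 + 1) + q.2.2 - 1 = q.1 + q.2.1 + q.2.2 by omega,
        show q.1 + (q.2.1 + 1) + t = q.1 + q.2.1 + (t+1) by omega,
        show q.2.1 + 1 + q.2.2 + r = q.2.1 + q.2.2 + (r+1) by omega, Nat.factorial_succ]
      have : ((q.2.1 : ℝ) + 1) ≠ 0 := by positivity
      push_cast
      field_simp
      try ring
    have P : HasSum (fun q : ℕ × ℕ × ℕ => ((q.2.2 : ℝ) * τ ^ (q.1 + q.2.1 + q.2.2 - 1)) * TT r s t u1 u2 u3 y1 y2 y3 q)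
        (u3 * Hser (r+1) (s+1) t (τ * u1) (τ * u2) (τ * u3) y1 y2 y3) := by
      refine shiftp _ _ (fun n p => by simp) ?_
      convert! (TTsum (r+1) (s+1) t _ _ _ y1 y2 y3 k1 k2 k3).mul_left u3 using 1
      funext q
      rw [TT_scale]
      simp only [TT]
      rw [show q.1 + q.2.1 + (q.2.2 + 1) - 1 = q.1 + q.2.1 + q.2.2 by omega,
        show q.2.2 + 1 + q.1 + s = q.2.2 + q.1 + (s+1) by omega,
        show q.2.1 + (q.2.2 + 1) + r = q.2.1 + q.2.2 + (r+1) by omega, Nat.factorial_succ]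
      have : ((q.2.2 : ℝ) + 1) ≠ 0 := by positivity
      push_cast
      field_simp
      try ring
    rw [← ((M.add N).add P).tsum_eq]
    refine tsum_congr (fun q => ?_)
    push_cast
    ring
  · intro q y _
    exact (hasDerivAt_pow _ y).mul_const _
  · intro q y hy
    have hy' : |y| ≤ c := le_of_lt (by simpa using hy)
    have b := H (c * u1) (c * u2) (c * u3) y1 y2 y3 q (hcu _ a1) (hcu _ a2) (hcu _ a3)
      (by simp) (by simp) (by simp)
    rw [TT_scale, abs_mul, abs_of_pos (by positivity)] at b
    rw [Real.norm_eq_abs, abs_mul, abs_mul, abs_pow, abs_of_nonneg (Nat.cast_nonneg _)]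
    calc _ ≤ (((q.1 + q.2.1 + q.2.2 : ℕ) : ℝ) * c ^ (q.1 + q.2.1 + q.2.2)) * |TT r s t u1 u2 u3 y1 y2 y3 q| := by
            gcongr ((_ * ?_) * _)
            calc |y| ^ (q.1 + q.2.1 + q.2.2 - 1) ≤ c ^ (q.1 + q.2.1 + q.2.2 - 1) := by gcongr
              _ ≤ _ := pow_le_pow_right₀ hc1.le (by omega)
      _ = ((q.1 + q.2.1 + q.2.2 : ℕ) : ℝ) * (c ^ (q.1 + q.2.1 + q.2.2) * |TT r s t u1 u2 u3 y1 y2 y3 q|) := by ring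
      _ ≤ ((q.1 + q.2.1 + q.2.2 : ℕ) : ℝ) * (K * θ ^ (q.1 + q.2.1 + q.2.2)) := by gcongr
      _ = _ := by ring
  · simp only [← TT_scale]
    exact (TTsum r s t _ _ _ y1 y2 y3 k1 k2 k3).summable

noncomputable def Nq (a b c y1 y2 y3 : ℝ) : ℝ :=
  (1 - 4*a^2) * y1^2 + (1 - 4*b^2) * y2^2 + (1 - 4*c^2) * y3^2
    + 2 * (4*a*b - 2*c) * y1 * y2 + 2 * (4*a*c - 2*b) * y1 * y3 + 2 * (4*b*c - 2*a) * y2 * y3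

lemma second (a b c y1 y2 y3 : ℝ) (h1 : |a| < 1/4) (h2 : |b| < 1/4)
    (h3 : |c| < 1/4) :
    (1 - 4*a^2 - 4*b^2 - 4*c^2 + 16*a*b*c)^2 * Hser 0 1 1 a b c y1 y2 y3 =
      (4 * ((4*a*b - 2*c) * y1 + (1-4*b^2) * y2 + (4*b*c - 2*a) * y3)
         * ((4*a*c - 2*b) * y1 + (4*b*c - 2*a) * y2 + (1-4*c^2) * y3)
       - 2 * (1 - 4*a^2 - 4*b^2 - 4*c^2 + 16*a*b*c) * (4*b*c - 2*a)) * Hser 0 0 0 a b c y1 y2 y3 := by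
  have r1 := row1 0 0 0 a b c y1 y2 y3 h1 h2 h3
  have r2 := row2 0 0 0 a b c y1 y2 y3 h1 h2 h3
  have r3 := row3 0 0 0 a b c y1 y2 y3 h1 h2 h3
  have s1 := row1 0 1 0 a b c y1 y2 y3 h1 h2 h3
  have s2 := row2 0 1 0 a b c y1 y2 y3 h1 h2 h3
  have s3 := row3 0 1 0 a b c y1 y2 y3 h1 h2 h3
  simp only [Nat.zero_add, Nat.cast_zero, Nat.cast_one, Nat.sub_self, Nat.zero_sub, mul_zero, mul_one, zero_mul, sub_zero, Nat.reduceAdd] at r1 r2 r3 s1 s2 s3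
  set D := (1 - 4*a^2 - 4*b^2 - 4*c^2 + 16*a*b*c) with hD
  have F2 : D * Hser 0 1 0 a b c y1 y2 y3 = 2 * ((4*a*b - 2*c) * y1 + (1-4*b^2) * y2 + (4*b*c - 2*a) * y3) * Hser 0 0 0 a b c y1 y2 y3 := by
    rw [hD]
    linear_combination (4*a*b - 2*c) * r1 + (1-4*b^2) * r2 + (4*b*c - 2*a) * r3
  have F23 : D * Hser 0 1 1 a b c y1 y2 y3 = 2 * ((4*a*c - 2*b) * y1 + (4*b*c - 2*a) * y2 + (1-4*c^2) * y3) * Hser 0 1 0 a b c y1 y2 y3 - 2 * (4*b*c - 2*a) * Hser 0 0 0 a b c y1 y2 y3 := by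
    rw [hD]
    linear_combination (4*a*c - 2*b) * s1 + (4*b*c - 2*a) * s2 + (1-4*c^2) * s3
  linear_combination D * F23 + 2 * ((4*a*c - 2*b) * y1 + (4*b*c - 2*a) * y2 + (1-4*c^2) * y3) * F2

lemma Hser_base (u1 u2 u3 y1 y2 y3 : ℝ) (h1 : |u1| < 1/4) (h2 : |u2| < 1/4)
    (h3 : |u3| < 1/4) :
    Hser 0 0 0 u1 u2 u3 y1 y2 y3 * √(1 - 4*u1^2 - 4*u2^2 - 4*u3^2 + 16*u1*u2*u3) *
      Real.exp (Nq u1 u2 u3 y1 y2 y3 / (1 - 4*u1^2 - 4*u2^2 - 4*u3^2 + 16*u1*u2*u3))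
      = Real.exp (y1^2 + y2^2 + y3^2) := by
  set D : ℝ → ℝ := fun τ => 1 - 4*(τ*u1)^2 - 4*(τ*u2)^2 - 4*(τ*u3)^2 + 16*(τ*u1)*(τ*u2)*(τ*u3) with hD
  set D' : ℝ → ℝ := fun τ => - 8*τ*u1^2 - 8*τ*u2^2 - 8*τ*u3^2 + 48*τ^2*u1*u2*u3 with hD'
  set Q : ℝ → ℝ := fun τ => Nq (τ*u1) (τ*u2) (τ*u3) y1 y2 y3 with hQ
  set Q' : ℝ → ℝ := fun τ => (- 8*τ*u1^2) * y1^2 + (- 8*τ*u2^2) * y2^2 + (- 8*τ*u3^2) * y3^2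
    + 2 * (8*τ*u1*u2 - 2*u3) * y1 * y2 + 2 * (8*τ*u1*u3 - 2*u2) * y1 * y3 + 2 * (8*τ*u2*u3 - 2*u1) * y2 * y3 with hQ'
  set F : ℝ → ℝ := fun τ => Hser 0 0 0 (τ * u1) (τ * u2) (τ * u3) y1 y2 y3 with hF
  have dD : ∀ τ, HasDerivAt D (D' τ) τ := by
    intro τ
    have e : D = fun τ => 1 + (- 4*u1^2 - 4*u2^2 - 4*u3^2) * τ^2 + 16*u1*u2*u3 * τ^3 := by
      funext τ; simp only [hD]; ring
    rw [e]
    refine ((((hasDerivAt_pow 2 τ).const_mul (- 4*u1^2 - 4*u2^2 - 4*u3^2)).const_add 1).add ((hasDerivAt_pow 3 τ).const_mul (16*u1*u2*u3))).congr_deriv ?_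
    simp only [hD']; push_cast; ring
  have dQ : ∀ τ, HasDerivAt Q (Q' τ) τ := by
    intro τ
    have e : Q = fun τ => (y1^2+y2^2+y3^2) + (-4*u1^2*y1^2 - 4*u2^2*y2^2 - 4*u3^2*y3^2 + 8*u1*u2*y1*y2 + 8*u1*u3*y1*y3+8*u2*u3*y2*y3) * τ^2 + (-4*u3*y1*y2-4*u2*y1*y3-4*u1*y2*y3) * τ^1 := by
      funext τ; simp only [hQ, Nq]; ring
    rw [e]
    refine ((((hasDerivAt_pow 2 τ).const_mul _).const_add _).add ((hasDerivAt_pow 1 τ).const_mul _)).congr_deriv ?_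
    simp only [hQ']; push_cast; ring
  have der : ∀ τ ∈ Set.Icc (0:ℝ) 1, HasDerivAt (fun τ => F τ * √(D τ) * Real.exp (Q τ / D τ)) 0 τ := by
    rintro τ ⟨t0, t1⟩
    have k1 := sc_lt τ u1 t0 t1 h1
    have k2 := sc_lt τ u2 t0 t1 h2
    have k3 := sc_lt τ u3 t0 t1 h3
    have Dpos : 0 < D τ := detpos _ _ _ k1 k2 k3
    have dF := Hser_tau 0 0 0 u1 u2 u3 y1 y2 y3 h1 h2 h3 τ t0 t1
    have e23 := second (τ*u1) (τ*u2) (τ*u3) y1 y2 y3 k1 k2 k3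
    have e31 := second (τ*u2) (τ*u3) (τ*u1) y2 y3 y1 k2 k3 k1
    have e12 := second (τ*u3) (τ*u1) (τ*u2) y3 y1 y2 k3 k1 k2
    simp only [← Hcyc 1 0 1, ← Hcyc 0 0 0] at e31
    rw [← Hcyc 1 0 1, ← Hcyc 1 1 0, ← Hcyc 0 0 0, ← Hcyc 0 0 0] at e12
    have g := (dF.mul ((dD τ).sqrt Dpos.ne')).mul (((dQ τ).div (dD τ) Dpos.ne').exp)
    refine g.congr_deriv ?_
    simp only [Nat.zero_add] 
    set G := Hser 0 0 0 (τ * u1) (τ * u2) (τ * u3) y1 y2 y3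
    set G1 := Hser 0 1 1 (τ * u1) (τ * u2) (τ * u3) y1 y2 y3
    set G2 := Hser 1 0 1 (τ * u1) (τ * u2) (τ * u3) y1 y2 y3
    set G3 := Hser 1 1 0 (τ * u1) (τ * u2) (τ * u3) y1 y2 y3
    have main : (D τ)^2 * (u1 * G1 + u2 * G2 + u3 * G3) + G * D τ * D' τ / 2 + G * (Q' τ * D τ - Q τ * D' τ) = 0 := by
      simp only [hD, hD', hQ, hQ', Nq]
      linear_combination u1 * e23 + u2 * e31 + u3 * e12
    have hs : √(D τ) ≠ 0 := (Real.sqrt_pos.2 Dpos).ne'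
    have hs2 : √(D τ) ^ 2 = D τ := Real.sq_sqrt Dpos.le
    have fin : (u1 * G1 + u2 * G2 + u3 * G3) * √(D τ) + G * (D' τ / (2 * √(D τ))) + G * √(D τ) * ((Q' τ * D τ - Q τ * D' τ) / D τ ^ 2) = 0 := by
      have : (u1 * G1 + u2 * G2 + u3 * G3) * √(D τ) + G * (D' τ / (2 * √(D τ))) + G * √(D τ) * ((Q' τ * D τ - Q τ * D' τ) / D τ ^ 2)
         = √(D τ) / (D τ)^2 * ((D τ)^2 * (u1 * G1 + u2 * G2 + u3 * G3) + G * D τ * D' τ / 2 + G * (Q' τ * D τ - Q τ * D' τ)) := by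
        have : D' τ / (2 * √(D τ)) = √(D τ) * D' τ / (2 * D τ) := by
          rw [div_eq_div_iff (by positivity) (by positivity)]
          linear_combination (-2 * D' τ) * hs2
        rw [this]
        field_simp
      rw [this, main, mul_zero]
    simp only [Pi.mul_apply, Pi.div_apply]
    change ((u1 * G1 + u2 * G2 + u3 * G3) * √(D τ) + G * (D' τ / (2 * √(D τ)))) * Real.exp (Q τ / D τ) + G * √(D τ) * (Real.exp (Q τ / D τ) * ((Q' τ * D τ - Q τ * D' τ) / D τ ^ 2)) = 0
    linear_combination Real.exp (Q τ / D τ) * fin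
  have cst := constant_of_has_deriv_right_zero (f := fun τ => F τ * √(D τ) * Real.exp (Q τ / D τ)) (a := 0) (b := 1)
    (fun τ hτ => (der τ hτ).continuousAt.continuousWithinAt)
    (fun τ hτ => (der τ ⟨hτ.1, hτ.2.le⟩).hasDerivWithinAt) 1 (by simp)
  simp only [hF, hD, hQ, one_mul, zero_mul, Hser_zero] at cst
  rw [cst]
  simp [Nq]

lemma sqrt_two_sq : √2 * √2 = (2:ℝ) := Real.mul_self_sqrt (by norm_num)

noncomputable def LL (u1 u2 u3 : ℝ) (r s t : ℕ) (x : Fin 3 → ℝ) : ℝ :=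
  Real.exp (-((x 0)^2 + (x 1)^2 + (x 2)^2)) *
        Hser r s t u1 u2 u3 (Real.sqrt 2 * x 0) (Real.sqrt 2 * x 1) (Real.sqrt 2 * x 2)

lemma exp_der (A z : ℝ) (G : ℝ → ℝ) (f g : ℝ)
    (hG : HasDerivAt G (2 * (√2 * z) * f - g) (√2 * z)) (hf : f = G (√2 * z)) :
    -(deriv (fun w => Real.exp (-(w^2 + A)) * G (√2 * w)) z) + 2 * z * (Real.exp (-(z^2 + A)) * f)
      = √2 * (Real.exp (-(z^2 + A)) * g) := by
  have h1 : HasDerivAt (fun w : ℝ => Real.exp (-(w^2 + A))) (Real.exp (-(z^2+A)) * (-(2 * z))) z := by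
    have := (((hasDerivAt_pow 2 z).add_const A).neg).exp
    simpa using this
  have h0 : HasDerivAt (fun w : ℝ => √2 * w) √2 z := by
    simpa using (hasDerivAt_id z).const_mul √2
  have h2 : HasDerivAt (fun w : ℝ => G (√2 * w)) ((2 * (√2 * z) * f - g) * √2) z :=
    HasDerivAt.comp z hG h0
  have h3 := (h1.mul h2).deriv
  rw [show (fun w => Real.exp (-(w^2 + A)) * G (√2 * w)) = (fun w : ℝ => Real.exp (-(w^2 + A))) * (fun w : ℝ => G (√2 * w)) from rfl, h3, ← hf]
  linear_combination (-2 * z * f * Real.exp (-(z^2+A))) * sqrt_two_sq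

section
variable (u1 u2 u3 : ℝ) (h1 : |u1| < 1/4) (h2 : |u2| < 1/4) (h3 : |u3| < 1/4)

lemma cr0 (h1 : |u1| < 1/4) (h2 : |u2| < 1/4) (h3 : |u3| < 1/4) (r s t : ℕ) :
    creation 0 (LL u1 u2 u3 r s t) = fun x => √2 * LL u1 u2 u3 (r+1) s t x := by
  funext x
  have := exp_der ((x 1)^2 + (x 2)^2) (x 0)
    (fun y => Hser r s t u1 u2 u3 y (√2 * x 1) (√2 * x 2)) _ _
    (Hser_deriv1 r s t u1 u2 u3 _ _ _ h1 h2 h3) rfl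
  simp only [← add_assoc] at this
  simpa [creation, pd, LL] using this

lemma cr1 (h1 : |u1| < 1/4) (h2 : |u2| < 1/4) (h3 : |u3| < 1/4) (r s t : ℕ) :
    creation 1 (LL u1 u2 u3 r s t) = fun x => √2 * LL u1 u2 u3 r (s+1) t x := by
  funext x
  have := exp_der ((x 0)^2 + (x 2)^2) (x 1)
    (fun y => Hser r s t u1 u2 u3 (√2 * x 0) y (√2 * x 2)) _ _
    (Hser_deriv2 r s t u1 u2 u3 _ _ _ h1 h2 h3) rfl
  have e : ∀ w : ℝ, w^2 + ((x 0)^2 + (x 2)^2) = (x 0)^2 + w^2 + (x 2)^2 := fun w => by ring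
  simp only [e] at this
  simpa [creation, pd, LL, Function.update] using this

lemma cr2 (h1 : |u1| < 1/4) (h2 : |u2| < 1/4) (h3 : |u3| < 1/4) (r s t : ℕ) :
    creation 2 (LL u1 u2 u3 r s t) = fun x => √2 * LL u1 u2 u3 r s (t+1) x := by
  funext x
  have := exp_der ((x 0)^2 + (x 1)^2) (x 2)
    (fun y => Hser r s t u1 u2 u3 (√2 * x 0) (√2 * x 1) y) _ _
    (Hser_deriv3 r s t u1 u2 u3 _ _ _ h1 h2 h3) rfl
  have e : ∀ w : ℝ, w^2 + ((x 0)^2 + (x 1)^2) = (x 0)^2 + (x 1)^2 + w^2 := fun w => by ring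
  simp only [e] at this
  simpa [creation, pd, LL, Function.update] using this
end

lemma cr_smul (j : Fin 3) (k : ℝ) (f : (Fin 3 → ℝ) → ℝ) :
    creation j (fun x => k * f x) = fun x => k * creation j f x := by
  funext x
  simp only [creation, pd, deriv_const_mul_field]
  ring

lemma cr_iter (j : Fin 3) (G : ℕ → (Fin 3 → ℝ) → ℝ)
    (hG : ∀ n, creation j (G n) = fun x => √2 * G (n+1) x) (k : ℝ) (n : ℕ) :
    (creation j)^[n] (fun x => k * G 0 x) = fun x => (k * √2^n) * G n x := by
  induction n with
  | zero => simp
  | succ n ih =>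
    rw [Function.iterate_succ_apply', ih, cr_smul, hG]
    funext x
    rw [pow_succ]; ring

lemma quad_eq (a b c : ℝ) (h1 : |a| < 1/4) (h2 : |b| < 1/4) (h3 : |c| < 1/4)
    (C : Matrix (Fin 3) (Fin 3) ℝ)
    (hC : C = (1 + (2 : ℝ) • Mmat a b c)⁻¹ * (1 - (2 : ℝ) • Mmat a b c)) (y : Fin 3 → ℝ) :
    ∑ i, ∑ j, y i * C i j * y j = 2 * (Nq a b c (y 0) (y 1) (y 2) / (1 - 4*a^2 - 4*b^2 - 4*c^2 + 16*a*b*c))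
      - ((y 0)^2 + (y 1)^2 + (y 2)^2) := by
  have hD := detpos a b c h1 h2 h3
  set D := 1 - 4*a^2 - 4*b^2 - 4*c^2 + 16*a*b*c with hDd
  have hinv : (1 + (2 : ℝ) • Mmat a b c)⁻¹ = D⁻¹ • !![1-4*a^2, 4*a*b-2*c, 4*a*c-2*b;
      4*a*b-2*c, 1-4*b^2, 4*b*c-2*a; 4*a*c-2*b, 4*b*c-2*a, 1-4*c^2] := by
    apply Matrix.inv_eq_right_inv
    rw [Matrix.mul_smul, inv_smul_eq_iff₀ hD.ne']
    ext i j
    fin_cases i <;> fin_cases j <;>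
      simp [Mmat, Matrix.mul_apply, Fin.sum_univ_three, Matrix.one_apply] <;> (try rw [hDd]) <;> ring
  rw [hC, hinv, Matrix.smul_mul]
  simp only [Matrix.smul_apply, Matrix.mul_apply, Fin.sum_univ_three, Matrix.sub_apply, Mmat]
  simp [Matrix.one_apply]
  field_simp
  rw [hDd, Nq]
  ring

lemma gauss_eq (a b c : ℝ) (h1 : |a| < 1/4) (h2 : |b| < 1/4) (h3 : |c| < 1/4)
    (C : Matrix (Fin 3) (Fin 3) ℝ)
    (hC : C = (1 + (2 : ℝ) • Mmat a b c)⁻¹ * (1 - (2 : ℝ) • Mmat a b c)) :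
    (fun y : Fin 3 → ℝ => Real.exp (-(∑ i, ∑ j, y i * C i j * y j))) =
    fun y => √(1 - 4*a^2 - 4*b^2 - 4*c^2 + 16*a*b*c) * LL a b c 0 0 0 y := by
  funext y
  rw [quad_eq a b c h1 h2 h3 C hC]
  have B := Hser_base a b c (√2 * y 0) (√2 * y 1) (√2 * y 2) h1 h2 h3
  have hN : Nq a b c (√2 * y 0) (√2 * y 1) (√2 * y 2) = 2 * Nq a b c (y 0) (y 1) (y 2) := by
    simp only [Nq]
    linear_combination ((1 - 4*a^2) * (y 0)^2 + (1 - 4*b^2) * (y 1)^2 + (1 - 4*c^2) * (y 2)^2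
    + 2 * (4*a*b - 2*c) * (y 0) * (y 1) + 2 * (4*a*c - 2*b) * (y 0) * (y 2) + 2 * (4*b*c - 2*a) * (y 1) * (y 2)) * sqrt_two_sq
  have hy : (√2 * y 0)^2 + (√2 * y 1)^2 + (√2 * y 2)^2 = 2 * ((y 0)^2 + (y 1)^2 + (y 2)^2) := by
    linear_combination ((y 0)^2 + (y 1)^2 + (y 2)^2) * sqrt_two_sq
  rw [hN, hy, mul_div_assoc] at B
  set E := 2 * (Nq a b c (y 0) (y 1) (y 2) / (1 - 4*a^2 - 4*b^2 - 4*c^2 + 16*a*b*c))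
  set S := (y 0)^2 + (y 1)^2 + (y 2)^2 with hS
  have h := Real.exp_pos E
  apply mul_right_cancel₀ h.ne'
  unfold LL
  rw [← hS]
  calc _ = Real.exp S := by rw [← Real.exp_add]; congr 1; ring
    _ = Real.exp (-S) * Real.exp (2 * S) := by rw [← Real.exp_add]; congr 1; ring
    _ = _ := by rw [← B]; ring

theorem stmt10 (r s t : ℕ) (u1 u2 u3 : ℝ)
    (h1 : |u1| < 1/4) (h2 : |u2| < 1/4) (h3 : |u3| < 1/4)
    (C : Matrix (Fin 3) (Fin 3) ℝ)
    (hC : C = (1 + (2 : ℝ) • Mmat u1 u2 u3)⁻¹ * (1 - (2 : ℝ) • Mmat u1 u2 u3))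
    (x : Fin 3 → ℝ) :
    (∀ y1 y2 y3 : ℝ, Summable (fun q : ℕ × ℕ × ℕ =>
      |Hpoly (q.2.1 + q.2.2 + r) y1 * Hpoly (q.2.2 + q.1 + s) y2 *
        Hpoly (q.1 + q.2.1 + t) y3 * u1 ^ q.1 * u2 ^ q.2.1 * u3 ^ q.2.2 /
        ((q.1.factorial : ℝ) * (q.2.1.factorial : ℝ) * (q.2.2.factorial : ℝ))|)) ∧
    Real.exp (-((x 0)^2 + (x 1)^2 + (x 2)^2)) *
        Hser r s t u1 u2 u3 (Real.sqrt 2 * x 0) (Real.sqrt 2 * x 1) (Real.sqrt 2 * x 2)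
      = (2 : ℝ) ^ (-(((r + s + t : ℕ) : ℝ))/2) *
        (1 - 4*u1^2 - 4*u2^2 - 4*u3^2 + 16*u1*u2*u3) ^ (-(1 : ℝ)/2) *
        ((creation 0)^[r] ((creation 1)^[s] ((creation 2)^[t]
          (fun y => Real.exp (-(∑ i, ∑ j, y i * C i j * y j)))))) x := by
  refine ⟨fun y1 y2 y3 => TTabs r s t u1 u2 u3 y1 y2 y3 h1 h2 h3, ?_⟩
  rw [gauss_eq u1 u2 u3 h1 h2 h3 C hC]
  have D0 := detpos u1 u2 u3 h1 h2 h3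
  set D := 1 - 4*u1^2 - 4*u2^2 - 4*u3^2 + 16*u1*u2*u3
  rw [cr_iter 2 (fun n => LL u1 u2 u3 0 0 n) (fun n => cr2 u1 u2 u3 h1 h2 h3 0 0 n)]
  rw [cr_iter 1 (fun n => LL u1 u2 u3 0 n t) (fun n => cr1 u1 u2 u3 h1 h2 h3 0 n t)]
  rw [cr_iter 0 (fun n => LL u1 u2 u3 n s t) (fun n => cr0 u1 u2 u3 h1 h2 h3 n s t)]
  change LL u1 u2 u3 r s t x = _
  have e1 : D ^ (-(1:ℝ)/2) * √D = 1 := by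
    rw [Real.sqrt_eq_rpow, ← Real.rpow_add D0]; norm_num
  have e2 : (2:ℝ) ^ (-(((r + s + t : ℕ) : ℝ))/2) * √2 ^ (r + s + t) = 1 := by
    rw [Real.sqrt_eq_rpow, ← Real.rpow_natCast, ← Real.rpow_mul (by norm_num), ← Real.rpow_add (by norm_num)]
    rw [show -(((r + s + t : ℕ) : ℝ))/2 + 1 / 2 * ((r + s + t : ℕ) : ℝ) = 0 by ring]
    simp
  rw [show (√D * √2 ^ t * √2 ^ s * √2 ^ r) = √D * √2 ^ (r + s + t) by rw [pow_add, pow_add]; ring]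
  calc LL u1 u2 u3 r s t x = (D ^ (-(1:ℝ)/2) * √D) * ((2:ℝ) ^ (-(((r + s + t : ℕ) : ℝ))/2) * √2 ^ (r + s + t)) * LL u1 u2 u3 r s t x := by rw [e1, e2]; ring
    _ = _ := by ring
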